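/- Assume α_k ≤ 1/(2L). For any vector g_k, let x_{k+1} = argmin_y ⟨g_k, y − x_k⟩ + φ(y) + (1/α_k) D_ω(y, x_k) and x̂_{k+1} = argmin_y ⟨∇f(x_k), y − x_k⟩ + φ(y) + (2/α_k) D_ω(y, x_k). Then Ψ(x_{k+1}) − Ψ(x_k) ≤ (α_k/2)‖∇f(x_k) − g_k‖² − (3/(2α_k) − L)‖x̂_{k+1} − x_k‖² − (1/(2α_k) − L/2)‖x_{k+1} − x_k‖². -/

import Mathlib

/-!
Statement 16 (Lemma 5.1, one-iteration improvement of the proximal step).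

Minimize `Ψ = f + φ` where `f` has an `L`-Lipschitz gradient and `φ` is convex.
`w` is a continuously differentiable `1`-strongly convex function with gradient `gw`,
and `D_w(x, y) = w x - w y - ⟪gw y, x - y⟫` is the associated Bregman distance.
If `0 < α_k ≤ 1/(2L)`, `x_{k+1}` minimizes `y ↦ ⟪g_k, y - x_k⟫ + φ y + (1/α_k) D_w(y, x_k)`
and `x̂_{k+1}` minimizes `y ↦ ⟪∇f(x_k), y - x_k⟫ + φ y + (2/α_k) D_w(y, x_k)`, then
`Ψ(x_{k+1}) - Ψ(x_k) ≤ (α_k/2)‖∇f(x_k) - g_k‖² - (3/(2α_k) - L)‖x̂_{k+1} - x_k‖²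
   - (1/(2α_k) - L/2)‖x_{k+1} - x_k‖²`.
-/

open scoped RealInnerProductSpace

section

variable {E : Type*} [NormedAddCommGroup E] [InnerProductSpace ℝ E] [CompleteSpace E]

theorem HasGradientAt.hasDerivAt_line {f : E → ℝ} {x v g : E} {t : ℝ}
    (h : HasGradientAt f g (x + t • v)) :
    HasDerivAt (fun s : ℝ => f (x + s • v)) ⟪g, v⟫ t := by
  have hl : HasDerivAt (fun s : ℝ => x + s • v) v t := by
    simpa using ((hasDerivAt_id t).smul_const v).const_add x
  simpa [Function.comp_def] using h.hasFDerivAt.comp_hasDerivAt t hl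

/-- The descent lemma for a function with Lipschitz gradient. -/
theorem le_add_inner_add_of_gradient_lipschitz {f : E → ℝ} {f' : E → E} {L : ℝ}
    (hf : ∀ x, HasGradientAt f (f' x) x) (hL : ∀ x y, ‖f' x - f' y‖ ≤ L * ‖x - y‖) (x y : E) :
    f y ≤ f x + ⟪f' x, y - x⟫ + L / 2 * ‖y - x‖ ^ 2 := by
  set v := y - x with hv
  have hd : ∀ t : ℝ, HasDerivAt
      (fun s : ℝ => f (x + s • v) - s * ⟪f' x, v⟫ - L / 2 * ‖v‖ ^ 2 * s ^ 2)
      (⟪f' (x + t • v), v⟫ - ⟪f' x, v⟫ - L / 2 * ‖v‖ ^ 2 * (2 * t)) t := fun t => by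
    refine ((((hf _).hasDerivAt_line).sub ((hasDerivAt_id t).mul_const ⟪f' x, v⟫)).sub
      (((hasDerivAt_id t).pow 2).const_mul (L / 2 * ‖v‖ ^ 2))).congr_deriv ?_
    simp
  have hanti := antitoneOn_of_deriv_nonpos (convex_Icc (0 : ℝ) 1)
    (fun t _ => (hd t).continuousAt.continuousWithinAt)
    (fun t _ => (hd t).differentiableAt.differentiableWithinAt)
    (fun t ht => by
      rw [interior_Icc] at ht
      rw [(hd t).deriv, ← inner_sub_left]
      have h₁ := real_inner_le_norm (f' (x + t • v) - f' x) v
      have h₂ := hL (x + t • v) x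
      rw [add_sub_cancel_left, norm_smul, Real.norm_of_nonneg ht.1.le] at h₂
      have h₃ := mul_le_mul_of_nonneg_right h₂ (norm_nonneg v)
      linarith)
  have h := hanti (Set.left_mem_Icc.2 zero_le_one) (Set.right_mem_Icc.2 zero_le_one) zero_le_one
  simp only [one_smul, zero_smul, add_zero, hv, add_sub_cancel] at h
  rw [← hv] at h
  linarith

/-- If `z` minimizes `h + φ` with `φ` convex, then minus the gradient of `h` at `z` is a
subgradient of `φ` at `z`. -/
theorem ConvexOn.sub_inner_le_of_isMinOn_add {φ h : E → ℝ} {z g : E}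
    (hφ : ConvexOn ℝ Set.univ φ) (hh : HasGradientAt h g z)
    (hmin : IsMinOn (fun y => h y + φ y) Set.univ z) (y : E) :
    φ z - ⟪g, y - z⟫ ≤ φ y := by
  have hd : HasDerivAt (fun s : ℝ => h (z + s • (y - z))) ⟪g, y - z⟫ 0 :=
    HasGradientAt.hasDerivAt_line (by simpa using hh)
  have hle : φ z - φ y ≤ ⟪g, y - z⟫ := by
    refine ge_of_tendsto hd.tendsto_slope_zero_right ?_
    filter_upwards [Ioc_mem_nhdsGT (zero_lt_one (α := ℝ))] with t ht
    have h₁ := isMinOn_univ_iff.1 hmin (z + t • (y - z))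
    have h₂ := hφ.2 (Set.mem_univ z) (Set.mem_univ y) (sub_nonneg.2 ht.2) ht.1.le
      (sub_add_cancel 1 t)
    rw [show (1 - t) • z + t • y = z + t • (y - z) by module] at h₂
    simp only [smul_eq_mul, zero_add, zero_smul, add_zero] at h₁ h₂ ⊢
    rw [inv_mul_eq_div, le_div_iff₀ ht.1]
    linarith
  linarith

/-- The three-point inequality for a Bregman proximal step. -/
theorem ConvexOn.bregman_prox_three_point {φ w : E → ℝ} {gw : E → E} {D : E → E → ℝ}
    (hφ : ConvexOn ℝ Set.univ φ) (hgw : ∀ x, HasGradientAt w (gw x) x)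
    (hD : ∀ x y, D x y = w x - w y - ⟪gw y, x - y⟫) {c : ℝ} {x z g : E}
    (hmin : IsMinOn (fun y => ⟪g, y - x⟫ + φ y + c * D y x) Set.univ z) (y : E) :
    ⟪g, z - x⟫ + φ z + c * D z x + c * D y z ≤ ⟪g, y - x⟫ + φ y + c * D y x := by
  have hin (u : E) : HasFDerivAt (fun y => ⟪u, y - x⟫) (innerSL ℝ u) z := by
    simpa [Function.comp_def] using
      (innerSL ℝ u).hasFDerivAt.comp z ((hasFDerivAt_id z).sub_const x)
  have hh : HasGradientAt (fun y => ⟪g, y - x⟫ + c * D y x) (g + c • (gw z - gw x)) z := by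
    simp only [hD]
    rw [hasGradientAt_iff_hasFDerivAt]
    refine ((hin g).add ((((hgw z).hasFDerivAt.sub_const (w x)).sub
      (hin (gw x))).const_mul c)).congr_fderiv ?_
    ext v
    simp
  have h := hφ.sub_inner_le_of_isMinOn_add hh
    (by simpa only [add_right_comm] using hmin) y
  simp only [hD, inner_add_left, inner_sub_left, inner_sub_right, real_inner_smul_left] at h ⊢
  linarith

end

theorem prox_one_iteration_improvement
    {E : Type*} [NormedAddCommGroup E] [InnerProductSpace ℝ E] [CompleteSpace E]
    (f φ : E → ℝ) (gradf : E → E) (L : ℝ)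
    (hgrad : ∀ x, HasGradientAt f (gradf x) x)
    (hLip : ∀ x y : E, ‖gradf x - gradf y‖ ≤ L * ‖x - y‖)
    (hφ : ConvexOn ℝ Set.univ φ)
    -- the distance-generating function `w`, its gradient and 1-strong convexity
    (w : E → ℝ) (gw : E → E)
    (hgw : ∀ x, HasGradientAt w (gw x) x)
    (hsc : ∀ x y : E, w y + ⟪gw y, x - y⟫ + (1 / 2) * ‖x - y‖ ^ 2 ≤ w x)
    -- Bregman distance
    (Dw : E → E → ℝ)
    (hDw : ∀ x y, Dw x y = w x - w y - ⟪gw y, x - y⟫)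
    -- iteration data
    (αk : ℝ) (hα0 : 0 < αk) (hαL : αk ≤ 1 / (2 * L))
    (xk gk xkp xhat : E)
    (hxkp : IsMinOn (fun y => ⟪gk, y - xk⟫ + φ y + (1 / αk) * Dw y xk) Set.univ xkp)
    (hxhat : IsMinOn (fun y => ⟪gradf xk, y - xk⟫ + φ y + (2 / αk) * Dw y xk) Set.univ xhat) :
    (f xkp + φ xkp) - (f xk + φ xk) ≤
      (αk / 2) * ‖gradf xk - gk‖ ^ 2
        - (3 / (2 * αk) - L) * ‖xhat - xk‖ ^ 2
        - (1 / (2 * αk) - L / 2) * ‖xkp - xk‖ ^ 2 := by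
  have hL : 0 < L := by
    by_contra! hL
    have := div_nonpos_of_nonneg_of_nonpos zero_le_one (show 2 * L ≤ 0 by linarith)
    linarith
  have hDge (x y : E) : 1 / 2 * ‖x - y‖ ^ 2 ≤ Dw x y := by
    linarith [hsc x y, hDw x y]
  have hDself : Dw xk xk = 0 := by simp [hDw]
  have h₁ := hφ.bregman_prox_three_point hgw hDw hxhat xk
  have h₂ := hφ.bregman_prox_three_point hgw hDw hxkp xhat
  have hdesc := le_add_inner_add_of_gradient_lipschitz hgrad hLip xk xkp
  have hyoung : ⟪gradf xk - gk, xkp - xhat⟫ ≤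
      αk / 2 * ‖gradf xk - gk‖ ^ 2 + (1 / αk) * (1 / 2 * ‖xhat - xkp‖ ^ 2) := by
    have hsq := sq_nonneg (αk * ‖gradf xk - gk‖ - ‖xhat - xkp‖)
    have hcs := real_inner_le_norm (gradf xk - gk) (xkp - xhat)
    rw [norm_sub_rev xkp xhat] at hcs
    refine hcs.trans (le_of_mul_le_mul_left ?_ hα0)
    field_simp
    linarith
  have hα : 0 ≤ 1 / αk := by positivity
  have hA := mul_le_mul_of_nonneg_left (hDge xhat xk) hα
  have hB := mul_le_mul_of_nonneg_left (hDge xk xhat) hα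
  have hC := mul_le_mul_of_nonneg_left (hDge xkp xk) hα
  have hD := mul_le_mul_of_nonneg_left (hDge xhat xkp) hα
  have hLn : 0 ≤ L * ‖xhat - xk‖ ^ 2 := by positivity
  rw [norm_sub_rev xk xhat] at hB
  rw [hDself] at h₁
  rw [show 3 / (2 * αk) = 3 / 2 * (1 / αk) by field_simp,
    show 1 / (2 * αk) = 1 / 2 * (1 / αk) by field_simp]
  rw [show 2 / αk = 2 * (1 / αk) by ring] at h₁
  simp only [inner_sub_left, inner_sub_right] at h₁ h₂ hdesc hyoung
  linarith
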